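/- arXiv:1312.4726 — 3 statements merged into one kernel-verified Lean document; each statement's English description precedes it below -/
import Mathlib

section
/- For all odd positive integers w₁ and w₂, every complex number s, and every real number x > 0, one has [2]_{q^{w₂}}^r · [w₂]_q^s · Σ_{j₁,...,j_r = 0}^{w₁d − 1} (−1)^{j₁+⋯+j_r} (Π_{l=1}^{r} χ(j_l)) q^{w₂·Σ_{l=1}^{r}(h−l+1)j_l} · l_{q^{w₁},r}^{(h)}(s, w₂x + (w₂/w₁)(j₁+⋯+j_r) | χ) = [2]_{q^{w₁}}^r · [w₁]_q^s · Σ_{j₁,...,j_r = 0}^{w₂d − 1} (−1)^{j₁+⋯+j_r} (Π_{l=1}^{r} χ(j_l)) q^{w₁·Σ_{l=1}^{r}(h−l+1)j_l} · l_{q^{w₂},r}^{(h)}(s, w₁x + (w₁/w₂)(j₁+⋯+j_r) | χ). -/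
open Finset

/-- The `q`-number `[x]_q = (1 - q^x)/(1 - q)`, with real exponent. -/
noncomputable def qnum (q x : ℝ) : ℝ := (1 - q ^ x) / (1 - q)

/-- For a positive real `y`, the complex power `y^s = exp(s · log y)`,
using the real logarithm. -/
noncomputable def rcpow (y : ℝ) (s : ℂ) : ℂ := Complex.exp (s * (Real.log y : ℂ))

/-- The Dirichlet-type multiple `(h,q)`-`l`-function
`l_{q,r}^{(h)}(s, x|χ) = [2]_q^r · Σ_{m₁,…,m_r ≥ 0} q^{Σ_l (h-l+1) m_l} (-1)^{m₁+⋯+m_r}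
  (Π_l χ(m_l)) / [m₁+⋯+m_r+x]_q^s`,
with the index `l` running over `Fin r` (0-based, so `h - l + 1` becomes `h - l`). -/
noncomputable def multipleqL {d : ℕ} (χ : DirichletCharacter ℂ d) (q : ℝ) (h : ℤ) (r : ℕ)
    (s : ℂ) (x : ℝ) : ℂ :=
  ((qnum q 2 : ℝ) : ℂ) ^ r *
    ∑' m : Fin r → ℕ,
      ((q ^ (∑ l : Fin r, (h - (l.val : ℤ)) * (m l : ℤ)) : ℝ) : ℂ) *
        (-1 : ℂ) ^ (∑ l : Fin r, m l) * (∏ l : Fin r, χ ((m l : ℕ) : ZMod d)) /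
        rcpow (qnum q ((∑ l : Fin r, (m l : ℝ)) + x)) s

lemma qnum_pos {q x : ℝ} (hq0 : 0 < q) (hq1 : q < 1) (hx : 0 < x) : 0 < qnum q x :=
  div_pos (sub_pos.2 (Real.rpow_lt_one hq0.le hq1 hx)) (sub_pos.2 hq1)

lemma qnum_le_qnum {q x y : ℝ} (hq0 : 0 < q) (hq1 : q < 1) (hxy : x ≤ y) :
    qnum q x ≤ qnum q y :=
  div_le_div_of_nonneg_right
    (sub_le_sub_left (Real.rpow_le_rpow_of_exponent_ge hq0 hq1.le hxy) 1) (sub_pos.2 hq1).le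

lemma qnum_le {q : ℝ} (hq0 : 0 < q) (hq1 : q < 1) (x : ℝ) : qnum q x ≤ 1 / (1 - q) :=
  div_le_div_of_nonneg_right (by linarith [Real.rpow_pos_of_pos hq0 x]) (sub_pos.2 hq1).le

lemma qnum_pow {q : ℝ} (hq0 : 0 < q) (hq1 : q < 1) {w : ℕ} (hw : 0 < w) (y : ℝ) :
    qnum (q ^ w) y = qnum q (w * y) / qnum q w := by
  have h1 : q ^ w < 1 := pow_lt_one₀ hq0.le hq1 hw.ne'
  have h2 : 1 - q ^ w ≠ 0 := (sub_pos.2 h1).ne'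
  have h3 : 1 - q ≠ 0 := (sub_pos.2 hq1).ne'
  simp only [qnum, Real.rpow_natCast, Real.rpow_natCast_mul hq0.le]
  field_simp

lemma rcpow_ne_zero (y : ℝ) (s : ℂ) : rcpow y s ≠ 0 := Complex.exp_ne_zero _

lemma rcpow_div {a b : ℝ} (ha : 0 < a) (hb : 0 < b) (s : ℂ) :
    rcpow (a / b) s = rcpow a s / rcpow b s := by
  rw [rcpow, rcpow, rcpow, Real.log_div ha.ne' hb.ne', ← Complex.exp_sub]
  push_cast
  ring_nf

lemma exists_norm_inv_rcpow_le {a b : ℝ} (ha : 0 < a) (s : ℂ) :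
    ∃ C : ℝ, ∀ y, a ≤ y → y ≤ b → ‖(rcpow y s)⁻¹‖ ≤ C := by
  have hc : ContinuousOn (fun y : ℝ => (rcpow y s)⁻¹) (Set.Icc a b) := by
    refine ContinuousOn.inv₀ ?_ fun y _ => rcpow_ne_zero y s
    refine Complex.continuous_exp.comp_continuousOn (continuousOn_const.mul ?_)
    refine Complex.continuous_ofReal.comp_continuousOn (Real.continuousOn_log.mono ?_)
    intro y hy
    exact (ha.trans_le hy.1).ne'
  obtain ⟨C, hC⟩ := isCompact_Icc.exists_bound_of_continuousOn hc
  exact ⟨C, fun y h1 h2 => hC y ⟨h1, h2⟩⟩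

lemma summable_pi_prod_pow {r : ℕ} {q : ℝ} (hq0 : 0 ≤ q) (hq1 : q < 1) :
    Summable fun m : Fin r → ℕ => ∏ l, q ^ m l := by
  refine summable_of_sum_le (c := ∏ _l : Fin r, (1 - q)⁻¹)
    (fun m => prod_nonneg fun l _ => pow_nonneg hq0 _) fun u => ?_
  have hsub : u ⊆ Fintype.piFinset fun l => u.image fun m => m l := by
    intro m hm
    exact Fintype.mem_piFinset.2 fun l => mem_image_of_mem _ hm
  refine (sum_le_sum_of_subset_of_nonneg hsub
    fun m _ _ => prod_nonneg fun l _ => pow_nonneg hq0 _).trans ?_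
  rw [← prod_univ_sum (fun l => u.image fun m => m l) fun _ k => q ^ k]
  refine prod_le_prod (fun l _ => sum_nonneg fun k _ => pow_nonneg hq0 _) fun l _ => ?_
  rw [← tsum_geometric_of_lt_one hq0 hq1]
  exact (summable_geometric_of_lt_one hq0 hq1).sum_le_tsum _ fun k _ => pow_nonneg hq0 k

lemma summable_multipleqL {d : ℕ} (χ : DirichletCharacter ℂ d) {q : ℝ} (hq0 : 0 < q)
    (hq1 : q < 1) {r : ℕ} {h : ℤ} (hhr : (r : ℤ) ≤ h) (s : ℂ) {x : ℝ} (hx : 0 < x) :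
    Summable fun m : Fin r → ℕ =>
      ((q ^ (∑ l : Fin r, (h - (l.val : ℤ)) * (m l : ℤ)) : ℝ) : ℂ) *
        (-1 : ℂ) ^ (∑ l : Fin r, m l) * (∏ l : Fin r, χ ((m l : ℕ) : ZMod d)) /
        rcpow (qnum q ((∑ l : Fin r, (m l : ℝ)) + x)) s := by
  obtain ⟨C, hC⟩ := exists_norm_inv_rcpow_le (b := 1 / (1 - q)) (qnum_pos hq0 hq1 hx) s
  refine Summable.of_norm_bounded ((summable_pi_prod_pow hq0.le hq1).mul_right C) fun m => ?_
  rw [div_eq_mul_inv, norm_mul, norm_mul, norm_mul, norm_pow, norm_neg, norm_one, one_pow,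
    mul_one, norm_prod, Complex.norm_real, Real.norm_of_nonneg (zpow_pos hq0 _).le]
  have hχ : ∏ l : Fin r, ‖χ ((m l : ℕ) : ZMod d)‖ ≤ 1 :=
    prod_le_one (fun l _ => norm_nonneg _) fun l _ => χ.norm_le_one _
  have hpow : q ^ (∑ l : Fin r, (h - (l.val : ℤ)) * (m l : ℤ)) ≤ ∏ l, q ^ m l := by
    rw [prod_pow_eq_pow_sum, ← zpow_natCast]
    refine zpow_le_zpow_right_of_le_one₀ hq0 hq1.le ?_
    push_cast
    refine sum_le_sum fun l _ => le_mul_of_one_le_left (by positivity) ?_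
    have := l.isLt
    omega
  have hprod : (0 : ℝ) ≤ ∏ l, q ^ m l := prod_nonneg fun l _ => pow_nonneg hq0.le _
  refine mul_le_mul ?_ (hC _ (qnum_le_qnum hq0 hq1 ?_) (qnum_le hq0 hq1 _)) (norm_nonneg _) hprod
  · exact (mul_le_mul hpow hχ (prod_nonneg fun l _ => norm_nonneg _) hprod).trans_eq (mul_one _)
  · exact le_add_of_nonneg_left (sum_nonneg fun l _ => Nat.cast_nonneg _)

/-- Summation over tuples of naturals, sorted by the residues of the entries modulo `N`. -/
lemma tsum_pi_nat_eq_sum_tsum {r N : ℕ} (hN : 0 < N) {f : (Fin r → ℕ) → ℂ} (hf : Summable f) :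
    ∑' m, f m = ∑ i : Fin r → Fin N, ∑' n : Fin r → ℕ, f fun l => n l * N + i l := by
  have : NeZero N := ⟨hN.ne'⟩
  let e : (Fin r → Fin N) × (Fin r → ℕ) ≃ (Fin r → ℕ) :=
    (Equiv.prodComm _ _).trans ((Equiv.arrowProdEquivProdArrow (Fin r) _ _).symm.trans
      (Equiv.piCongrRight fun _ => (Nat.divModEquiv N).symm))
  have he : Summable fun p => f (e p) := e.summable_iff.2 hf
  rw [← e.tsum_eq, he.tsum_prod, tsum_fintype]
  rfl

/-- The general term of the expansion of either side of the symmetry identity; it is unchanged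
when `(w₁, j)` and `(w₂, i)` are exchanged. -/
noncomputable def symmetricTerm {d : ℕ} (χ : DirichletCharacter ℂ d) (q : ℝ) (h : ℤ) {r : ℕ}
    (s : ℂ) (x : ℝ) (w₁ w₂ : ℕ) (j i n : Fin r → ℕ) : ℂ :=
  (-1 : ℂ) ^ (∑ l, (j l + i l + n l)) *
    (∏ l, χ ((j l : ℕ) : ZMod d) * χ ((i l : ℕ) : ZMod d)) *
    ((q ^ (∑ l : Fin r, (h - (l.val : ℤ)) *
      ((w₂ * j l + w₁ * i l + w₁ * w₂ * d * n l : ℕ) : ℤ)) : ℝ) : ℂ) *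
    (rcpow (qnum q w₁) s * rcpow (qnum q w₂) s /
      rcpow (qnum q ((∑ l, ((w₂ * j l + w₁ * i l + w₁ * w₂ * d * n l : ℕ) : ℝ)) +
        w₁ * w₂ * x)) s)

lemma symmetricTerm_comm {d : ℕ} (χ : DirichletCharacter ℂ d) (q : ℝ) (h : ℤ) {r : ℕ}
    (s : ℂ) (x : ℝ) (w₁ w₂ : ℕ) (j i n : Fin r → ℕ) :
    symmetricTerm χ q h s x w₁ w₂ j i n = symmetricTerm χ q h s x w₂ w₁ i j n := by
  have key (l : Fin r) : w₂ * j l + w₁ * i l + w₁ * w₂ * d * n l =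
      w₁ * i l + w₂ * j l + w₂ * w₁ * d * n l := by ring
  have hs (l : Fin r) : j l + i l + n l = i l + j l + n l := by ring
  simp only [symmetricTerm, key, hs, mul_comm (χ ((j _ : ℕ) : ZMod d)),
    mul_comm (rcpow (qnum q w₁) s), mul_comm (w₁ : ℝ) w₂]

lemma mul_multipleqL_eq_sum_tsum_symmetricTerm {d : ℕ} (hd0 : 0 < d) (hdodd : Odd d)
    (χ : DirichletCharacter ℂ d) {q : ℝ} (hq0 : 0 < q) (hq1 : q < 1)
    {r : ℕ} {h : ℤ} (hhr : (r : ℤ) ≤ h)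
    {w₁ w₂ : ℕ} (hw₁ : 0 < w₁) (hw₂ : 0 < w₂) (hw₂odd : Odd w₂)
    (s : ℂ) {x : ℝ} (hx : 0 < x) (j : Fin r → ℕ) :
    rcpow (qnum q w₂) s *
        ((-1 : ℂ) ^ (∑ l, j l) * (∏ l, χ ((j l : ℕ) : ZMod d)) *
          ((q ^ ((w₂ : ℤ) * ∑ l : Fin r, (h - (l.val : ℤ)) * (j l : ℤ)) : ℝ) : ℂ) *
          multipleqL χ (q ^ w₁) h r s
            ((w₂ : ℝ) * x + ((w₂ : ℝ) / (w₁ : ℝ)) * ∑ l, (j l : ℝ))) =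
      ((qnum (q ^ w₁) 2 : ℝ) : ℂ) ^ r * ∑ i : Fin r → Fin (w₂ * d), ∑' n : Fin r → ℕ,
        symmetricTerm χ q h s x w₁ w₂ j (fun l => i l) n := by
  have hw₁' : (0 : ℝ) < w₁ := Nat.cast_pos.2 hw₁
  have hw₂' : (0 : ℝ) < w₂ := Nat.cast_pos.2 hw₂
  have hy : 0 < (w₂ : ℝ) * x + ((w₂ : ℝ) / (w₁ : ℝ)) * ∑ l, (j l : ℝ) := by positivity
  have hQ0 : 0 < q ^ w₁ := pow_pos hq0 _
  have hQ1 : q ^ w₁ < 1 := pow_lt_one₀ hq0.le hq1 hw₁.ne'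
  rw [multipleqL, tsum_pi_nat_eq_sum_tsum (Nat.mul_pos hw₂ hd0)
    (summable_multipleqL χ hQ0 hQ1 hhr s hy), mul_left_comm _ (_ ^ r), mul_left_comm _ (_ ^ r)]
  congr 1
  rw [← mul_assoc]
  refine (mul_sum _ _ _).trans
    (sum_congr rfl fun i _ => tsum_mul_left.symm.trans (tsum_congr fun n => ?_))
  have hsign : (-1 : ℂ) ^ (∑ l, (n l * (w₂ * d) + i l)) = (-1 : ℂ) ^ (∑ l, ((i l : ℕ) + n l)) := by
    simp only [← prod_pow_eq_pow_sum]
    refine prod_congr rfl fun l _ => ?_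
    rw [pow_add, pow_add, mul_comm (n l), pow_mul, (hw₂odd.mul hdodd).neg_one_pow, mul_comm]
  have hχ (l : Fin r) : χ ((n l * (w₂ * d) + i l : ℕ) : ZMod d) = χ ((i l : ℕ) : ZMod d) := by
    simp
  have hpow : q ^ ((w₂ : ℤ) * ∑ l : Fin r, (h - (l.val : ℤ)) * (j l : ℤ)) *
      (q ^ w₁) ^ (∑ l : Fin r, (h - (l.val : ℤ)) * ((n l * (w₂ * d) + i l : ℕ) : ℤ)) =
      q ^ (∑ l : Fin r, (h - (l.val : ℤ)) *
        ((w₂ * j l + w₁ * i l + w₁ * w₂ * d * n l : ℕ) : ℤ)) := by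
    rw [← zpow_natCast q w₁, ← zpow_mul, ← zpow_add₀ hq0.ne', mul_sum, mul_sum,
      ← sum_add_distrib]
    congr 1
    refine sum_congr rfl fun l _ => ?_
    push_cast
    ring
  have harg : (w₁ : ℝ) * ((∑ l, ((n l * (w₂ * d) + i l : ℕ) : ℝ)) +
      (w₂ * x + (w₂ / w₁) * ∑ l, (j l : ℝ))) =
      (∑ l, ((w₂ * j l + w₁ * i l + w₁ * w₂ * d * n l : ℕ) : ℝ)) + w₁ * w₂ * x := by
    have hcancel : (w₁ : ℝ) * ((w₂ / w₁) * ∑ l, (j l : ℝ)) = w₂ * ∑ l, (j l : ℝ) := by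
      field_simp
    rw [mul_add, mul_add, hcancel, ← mul_assoc, add_comm (_ * x), ← add_assoc, mul_sum, mul_sum,
      ← sum_add_distrib]
    congr 1
    refine sum_congr rfl fun l _ => ?_
    push_cast
    ring
  have hnum : 0 < qnum q ((∑ l, ((w₂ * j l + w₁ * i l + w₁ * w₂ * d * n l : ℕ) : ℝ)) +
      w₁ * w₂ * x) := qnum_pos hq0 hq1 (by positivity)
  rw [qnum_pow hq0 hq1 hw₁, harg, rcpow_div hnum (qnum_pos hq0 hq1 hw₁'), hsign,
    symmetricTerm, ← hpow, prod_mul_distrib]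
  simp only [hχ, add_assoc (j _)]
  rw [sum_add_distrib (f := j), pow_add]
  push_cast
  have h1 := rcpow_ne_zero (qnum q w₁) s
  field_simp

/-- Theorem 2.1 (identity of symmetry for the Dirichlet-type multiple
`(h,q)`-`l`-function): for odd `w₁, w₂ ∈ ℕ`, `s ∈ ℂ` and `x > 0`,
`[2]_{q^{w₂}}^r [w₂]_q^s Σ_{j₁,…,j_r=0}^{w₁d-1} (-1)^{Σ j_l} (Π χ(j_l))
    q^{w₂ Σ (h-l+1) j_l} l_{q^{w₁},r}^{(h)}(s, w₂x + (w₂/w₁)Σ j_l | χ)`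
is symmetric under interchanging `w₁` and `w₂`. -/
theorem multipleqL_symmetry {d : ℕ} (hd0 : 0 < d) (hdodd : Odd d)
    (χ : DirichletCharacter ℂ d) (q : ℝ) (hq0 : 0 < q) (hq1 : q < 1)
    (r : ℕ) (hr : 1 ≤ r) (h : ℤ) (hhr : (r : ℤ) ≤ h)
    (w₁ w₂ : ℕ) (hw₁ : 0 < w₁) (hw₁odd : Odd w₁) (hw₂ : 0 < w₂) (hw₂odd : Odd w₂)
    (s : ℂ) (x : ℝ) (hx : 0 < x) :
    ((qnum (q ^ w₂) 2 : ℝ) : ℂ) ^ r * rcpow (qnum q w₂) s *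
        ∑ j : Fin r → Fin (w₁ * d),
          (-1 : ℂ) ^ (∑ l : Fin r, (j l : ℕ)) * (∏ l : Fin r, χ ((j l : ℕ) : ZMod d)) *
            ((q ^ ((w₂ : ℤ) * ∑ l : Fin r, (h - (l.val : ℤ)) * ((j l : ℕ) : ℤ)) : ℝ) : ℂ) *
            multipleqL χ (q ^ w₁) h r s
              ((w₂ : ℝ) * x + ((w₂ : ℝ) / (w₁ : ℝ)) * ∑ l : Fin r, ((j l : ℕ) : ℝ))
      = ((qnum (q ^ w₁) 2 : ℝ) : ℂ) ^ r * rcpow (qnum q w₁) s *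
        ∑ j : Fin r → Fin (w₂ * d),
          (-1 : ℂ) ^ (∑ l : Fin r, (j l : ℕ)) * (∏ l : Fin r, χ ((j l : ℕ) : ZMod d)) *
            ((q ^ ((w₁ : ℤ) * ∑ l : Fin r, (h - (l.val : ℤ)) * ((j l : ℕ) : ℤ)) : ℝ) : ℂ) *
            multipleqL χ (q ^ w₂) h r s
              ((w₁ : ℝ) * x + ((w₁ : ℝ) / (w₂ : ℝ)) * ∑ l : Fin r, ((j l : ℕ) : ℝ)) := by
  have left := sum_congr (s₁ := univ) rfl fun (j : Fin r → Fin (w₁ * d)) _ =>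
    mul_multipleqL_eq_sum_tsum_symmetricTerm hd0 hdodd χ hq0 hq1 hhr hw₁ hw₂ hw₂odd s hx
      fun l => (j l : ℕ)
  have right := sum_congr (s₁ := univ) rfl fun (j : Fin r → Fin (w₂ * d)) _ =>
    mul_multipleqL_eq_sum_tsum_symmetricTerm hd0 hdodd χ hq0 hq1 hhr hw₂ hw₁ hw₁odd s hx
      fun l => (j l : ℕ)
  rw [mul_assoc, mul_assoc, mul_sum _ _ (rcpow (qnum q w₂) s), mul_sum _ _ (rcpow (qnum q w₁) s),
    left, right, ← mul_sum, ← mul_sum, mul_left_comm, sum_comm]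
  simp only [symmetricTerm_comm χ q h s x w₁ w₂]
end

section
/- For every integer n ≥ 0, all odd positive integers w₁ and w₂, and every real number x > 0, one has [2]_{q^{w₂}}^r · Σ_{i=0}^{n} C(n,i) [w₁]_q^{n−i} [w₂]_q^{i} · E_{n−i,χ,q^{w₁}}^{(h,r)}(w₂x) · S_{n,i,q^{w₂}}^{(h,r)}(w₁d | χ) = [2]_{q^{w₁}}^r · Σ_{i=0}^{n} C(n,i) [w₂]_q^{n−i} [w₁]_q^{i} · E_{n−i,χ,q^{w₂}}^{(h,r)}(w₁x) · S_{n,i,q^{w₁}}^{(h,r)}(w₂d | χ), where C(n,i) denotes the binomial coefficient. -/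
open Finset

/-- The generalized higher-order `(h,q)`-Euler polynomial attached to a Dirichlet
character `χ` modulo `d`:
`E_{n,χ,q}^{(h,r)}(x) = [2]_q^r · Σ_{m₁,…,m_r ≥ 0} q^{Σ_l (h-l+1) m_l} (-1)^{m₁+⋯+m_r}
  (Π_l χ(m_l)) [x + m₁ + ⋯ + m_r]_q^n`,
where the summation index `l` runs over `Fin r` (so `h - l + 1` in 1-based indexing
becomes `h - l` in 0-based indexing). -/
noncomputable def genqEuler {d : ℕ} (χ : DirichletCharacter ℂ d) (q : ℝ) (h : ℤ) (r : ℕ)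
    (n : ℕ) (x : ℝ) : ℂ :=
  ((qnum q 2 : ℝ) : ℂ) ^ r *
    ∑' m : Fin r → ℕ,
      ((q ^ (∑ l : Fin r, (h - (l.val : ℤ)) * (m l : ℤ)) : ℝ) : ℂ) *
        (-1 : ℂ) ^ (∑ l : Fin r, m l) * (∏ l : Fin r, χ ((m l : ℕ) : ZMod d)) *
        ((qnum q (x + ∑ l : Fin r, (m l : ℝ)) ^ n : ℝ) : ℂ)

/-- The alternating generalized `q`-power sum
`S_{n,i,q}^{(h,r)}(w|χ) = Σ_{j₁,…,j_r=0}^{w-1} (-1)^{j₁+⋯+j_r} q^{Σ_l (h-l+n-i+1) j_l}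
  [j₁+⋯+j_r]_q^i (Π_l χ(j_l))`,
with the index `l` running over `Fin r` (0-based, so `h-l+n-i+1` becomes `h-l+n-i`). -/
noncomputable def altqPowerSum {d : ℕ} (χ : DirichletCharacter ℂ d) (q : ℝ) (h : ℤ) (r : ℕ)
    (n i : ℕ) (w : ℕ) : ℂ :=
  ∑ j : Fin r → Fin w,
    (-1 : ℂ) ^ (∑ l : Fin r, (j l : ℕ)) *
      ((q ^ (∑ l : Fin r, (h - (l.val : ℤ) + (n : ℤ) - (i : ℤ)) * ((j l : ℕ) : ℤ)) : ℝ) : ℂ) *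
      ((qnum q (∑ l : Fin r, ((j l : ℕ) : ℝ)) ^ i : ℝ) : ℂ) *
      (∏ l : Fin r, χ ((j l : ℕ) : ZMod d))

theorem qnum_mul {q : ℝ} (hq0 : 0 < q) (hq1 : q < 1) {a : ℕ} (ha : 0 < a) (y : ℝ) :
    qnum q a * qnum (q ^ a) y = qnum q (a * y) := by
  have h1 : 1 - q ≠ 0 := by linarith
  have h2 : 1 - q ^ a ≠ 0 := by
    have := pow_lt_one₀ hq0.le hq1 ha.ne'
    linarith
  unfold qnum
  rw [Real.rpow_natCast_mul hq0.le, Real.rpow_natCast]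
  field_simp

theorem qnum_add {q : ℝ} (hq0 : 0 < q) (x : ℝ) (m : ℕ) :
    qnum q (x + m) = q ^ m * qnum q x + qnum q m := by
  unfold qnum
  rw [Real.rpow_add hq0, Real.rpow_natCast]
  ring

theorem abs_qnum_add_natCast_le {q : ℝ} (hq0 : 0 < q) (hq1 : q < 1) (x : ℝ) (m : ℕ) :
    |qnum q (x + m)| ≤ (1 + q ^ x) / (1 - q) := by
  have h1 : 0 < 1 - q := by linarith
  have hx : 0 < q ^ x := Real.rpow_pos_of_pos hq0 x
  have hle : q ^ (x + m) ≤ q ^ x :=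
    Real.rpow_le_rpow_of_exponent_ge hq0 hq1.le (le_add_of_nonneg_right m.cast_nonneg)
  have hpos : 0 < q ^ (x + m) := Real.rpow_pos_of_pos hq0 _
  unfold qnum
  rw [abs_div, abs_of_pos h1]
  gcongr
  rw [abs_le]
  constructor <;> linarith

/-- The weight `q^{Σ_l (h-l) m_l}`, with `l` running over `Fin r`. -/
noncomputable def qWeight (q : ℝ) (h : ℤ) {r : ℕ} (m : Fin r → ℕ) : ℝ :=
  q ^ (∑ l : Fin r, (h - (l.val : ℤ)) * (m l : ℤ))

theorem qWeight_add {q : ℝ} (hq : q ≠ 0) (h : ℤ) {r : ℕ} (m k : Fin r → ℕ) :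
    qWeight q h (m + k) = qWeight q h m * qWeight q h k := by
  simp [qWeight, mul_add, Finset.sum_add_distrib, zpow_add₀ hq]

theorem qWeight_pow (q : ℝ) (h : ℤ) {r : ℕ} (a : ℕ) (m : Fin r → ℕ) :
    qWeight (q ^ a) h m = qWeight q h (a • m) := by
  unfold qWeight
  rw [← zpow_natCast, ← zpow_mul, Finset.mul_sum]
  congr 1
  refine Finset.sum_congr rfl fun l _ => ?_
  simp only [Pi.smul_apply, smul_eq_mul, Nat.cast_mul]
  ring

theorem qWeight_nonneg {q : ℝ} (hq : 0 ≤ q) (h : ℤ) {r : ℕ} (m : Fin r → ℕ) :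
    0 ≤ qWeight q h m := zpow_nonneg hq _

theorem qWeight_le_prod {q : ℝ} (hq0 : 0 < q) (hq1 : q < 1) {h : ℤ} {r : ℕ} (hhr : (r : ℤ) ≤ h)
    (m : Fin r → ℕ) : qWeight q h m ≤ ∏ l, q ^ m l := by
  rw [Finset.prod_pow_eq_pow_sum, ← zpow_natCast]
  refine zpow_le_zpow_right_of_le_one₀ hq0 hq1.le ?_
  rw [Nat.cast_sum]
  refine Finset.sum_le_sum fun l _ => ?_
  have := l.isLt
  exact le_mul_of_one_le_left (Int.natCast_nonneg _) (by omega)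

/-- The product `(-1)^{m₁+⋯+m_r} Π_l χ(m_l)`. -/
noncomputable def charSign {d : ℕ} (χ : DirichletCharacter ℂ d) {r : ℕ} (m : Fin r → ℕ) : ℂ :=
  (-1 : ℂ) ^ (∑ l : Fin r, m l) * ∏ l : Fin r, χ ((m l : ℕ) : ZMod d)

theorem norm_charSign_le_one {d : ℕ} (χ : DirichletCharacter ℂ d) {r : ℕ} (m : Fin r → ℕ) :
    ‖charSign χ m‖ ≤ 1 := by
  rw [charSign, norm_mul, norm_pow, norm_neg, norm_one, one_pow, one_mul, norm_prod]
  exact Finset.prod_le_one (fun _ _ => norm_nonneg _) fun _ _ => χ.norm_le_one _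

theorem charSign_add_mul {d : ℕ} (hd : Odd d) (χ : DirichletCharacter ℂ d) {r : ℕ} {b : ℕ}
    (hb : Odd b) (m k : Fin r → ℕ) :
    charSign χ (m + (b * d) • k) = (-1 : ℂ) ^ (∑ l, k l) * charSign χ m := by
  have h1 : (-1 : ℂ) ^ (b * d) = -1 := (hb.mul hd).neg_one_pow
  simp only [charSign, Pi.add_apply, Pi.smul_apply, smul_eq_mul, Finset.sum_add_distrib,
    ← Finset.mul_sum, pow_add, pow_mul (-1 : ℂ) (b * d), h1, Nat.cast_add, Nat.cast_mul,
    CharP.cast_eq_zero, mul_zero, zero_mul, add_zero]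
  ring

theorem summable_prod_pow {q : ℝ} (hq0 : 0 ≤ q) (hq1 : q < 1) (r : ℕ) :
    Summable fun m : Fin r → ℕ => ∏ l, q ^ m l := by
  induction r with
  | zero => exact Summable.of_finite
  | succ r ih =>
    rw [← (Fin.consEquiv fun _ : Fin (r + 1) => ℕ).summable_iff]
    refine ((summable_geometric_of_lt_one hq0 hq1).mul_of_nonneg ih
      (fun _ => pow_nonneg hq0 _)
      fun _ => Finset.prod_nonneg fun _ _ => pow_nonneg hq0 _).congr fun p => ?_
    simp [Fin.consEquiv, Fin.prod_univ_succ]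

/-- The summand `q^{Σ_l (h-l) m_l} [y + m₁ + ⋯ + m_r]_q^n`. -/
noncomputable def qTerm (q : ℝ) (h : ℤ) {r : ℕ} (n : ℕ) (y : ℝ) (m : Fin r → ℕ) : ℝ :=
  qWeight q h m * qnum q (y + (∑ l, m l : ℕ)) ^ n

theorem summable_charSign_mul_qTerm {d : ℕ} (χ : DirichletCharacter ℂ d) {q : ℝ} (hq0 : 0 < q)
    (hq1 : q < 1) {r : ℕ} {h : ℤ} (hhr : (r : ℤ) ≤ h) (n : ℕ) {a : ℕ} (ha : 0 < a) (y : ℝ)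
    (k : Fin r → ℕ) :
    Summable fun m : Fin r → ℕ => charSign χ m * (qTerm q h n y (a • m + k) : ℂ) := by
  refine Summable.of_norm_bounded
    ((summable_prod_pow hq0.le hq1 r).mul_right (((1 + q ^ y) / (1 - q)) ^ n)) fun m => ?_
  rw [norm_mul, Complex.norm_real, qTerm, norm_mul, norm_pow]
  refine (mul_le_of_le_one_left (by positivity) (norm_charSign_le_one χ m)).trans ?_
  have hprod : (0 : ℝ) ≤ ∏ l, q ^ m l := Finset.prod_nonneg fun _ _ => pow_nonneg hq0.le _
  gcongr
  · rw [Real.norm_of_nonneg (qWeight_nonneg hq0.le h _)]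
    refine (qWeight_le_prod hq0 hq1 hhr _).trans
      (Finset.prod_le_prod (fun _ _ => pow_nonneg hq0.le _) fun l _ => ?_)
    refine pow_le_pow_of_le_one hq0.le hq1.le ?_
    simp only [Pi.add_apply, Pi.smul_apply, smul_eq_mul]
    exact (Nat.le_mul_of_pos_left _ ha).trans (Nat.le_add_right _ _)
  · exact abs_qnum_add_natCast_le hq0 hq1 y _

theorem qnum_pow_mul_genqEuler {d : ℕ} (χ : DirichletCharacter ℂ d) {q : ℝ} (hq0 : 0 < q)
    (hq1 : q < 1) (h : ℤ) (r n : ℕ) {a : ℕ} (ha : 0 < a) (y : ℝ) :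
    ((qnum q a ^ n : ℝ) : ℂ) * genqEuler χ (q ^ a) h r n y =
      ((qnum (q ^ a) 2 : ℝ) : ℂ) ^ r *
        ∑' m : Fin r → ℕ, charSign χ m * (qTerm q h n (a * y) (a • m) : ℂ) := by
  rw [genqEuler, mul_left_comm, ← tsum_mul_left]
  congr 1
  refine tsum_congr fun m => ?_
  have hq : qnum q (a * y + (∑ l, (a • m) l : ℕ)) =
      qnum q a * qnum (q ^ a) (y + ∑ l, (m l : ℝ)) := by
    rw [qnum_mul hq0 hq1 ha]
    simp [mul_add, Finset.mul_sum]
  rw [qTerm, hq, ← qWeight_pow, mul_pow, charSign, qWeight]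
  push_cast
  ring

theorem qnum_pow_mul_altqPowerSum {d : ℕ} (χ : DirichletCharacter ℂ d) {q : ℝ} (hq0 : 0 < q)
    (hq1 : q < 1) (h : ℤ) (r : ℕ) {n i : ℕ} (hi : i ≤ n) {b : ℕ} (hb : 0 < b) (w : ℕ) :
    ((qnum q b ^ i : ℝ) : ℂ) * altqPowerSum χ (q ^ b) h r n i w =
      ∑ j : Fin r → Fin w, charSign χ (fun l => (j l : ℕ)) *
        ((qWeight q h (b • fun l => (j l : ℕ)) *
          ((q ^ ∑ l, b * (j l : ℕ)) ^ (n - i) *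
            qnum q (∑ l, b * (j l : ℕ) : ℕ) ^ i) : ℝ) : ℂ) := by
  rw [altqPowerSum, Finset.mul_sum]
  refine Finset.sum_congr rfl fun j _ => ?_
  have hq : qnum q (∑ l, b * (j l : ℕ) : ℕ) =
      qnum q b * qnum (q ^ b) (∑ l, ((j l : ℕ) : ℝ)) := by
    rw [qnum_mul hq0 hq1 hb]
    simp [Finset.mul_sum]
  have hw : (q ^ b) ^ (∑ l : Fin r, (h - (l.val : ℤ) + (n : ℤ) - (i : ℤ)) * ((j l : ℕ) : ℤ)) =
      qWeight q h (b • fun l => (j l : ℕ)) * (q ^ ∑ l, b * (j l : ℕ)) ^ (n - i) := by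
    have hsum : ∑ l : Fin r, (h - (l.val : ℤ) + (n : ℤ) - (i : ℤ)) * ((j l : ℕ) : ℤ) =
        ∑ l : Fin r, (h - (l.val : ℤ)) * ((j l : ℕ) : ℤ) +
          (((∑ l, (j l : ℕ)) * (n - i) : ℕ) : ℤ) := by
      push_cast [hi]
      rw [Finset.sum_mul, ← Finset.sum_add_distrib]
      exact Finset.sum_congr rfl fun l _ => by ring
    rw [hsum, zpow_add₀ (pow_pos hq0 b).ne', zpow_natCast, ← qWeight_pow, qWeight,
      ← Finset.mul_sum, pow_mul, pow_mul]
  rw [hq, hw, charSign, mul_pow]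
  push_cast
  ring

theorem sum_choose_mul_qTerm {q : ℝ} (hq0 : 0 < q) (h : ℤ) {r : ℕ} (n : ℕ) (y : ℝ)
    (m k : Fin r → ℕ) :
    ∑ i ∈ Finset.range (n + 1), (n.choose i : ℝ) * qTerm q h (n - i) y m *
      (qWeight q h k * ((q ^ ∑ l, k l) ^ (n - i) * qnum q (∑ l, k l : ℕ) ^ i)) =
      qTerm q h n y (m + k) := by
  have hs : (y + (∑ l, (m + k) l : ℕ) : ℝ) = y + (∑ l, m l : ℕ) + (∑ l, k l : ℕ) := by
    simp [Finset.sum_add_distrib, add_assoc]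
  rw [qTerm, hs, qnum_add hq0, qWeight_add hq0.ne', add_comm (_ * _), add_pow, Finset.mul_sum]
  refine Finset.sum_congr rfl fun i _ => ?_
  rw [qTerm, mul_pow]
  ring

theorem sum_genqEuler_mul_altqPowerSum {d : ℕ} (χ : DirichletCharacter ℂ d) {q : ℝ}
    (hq0 : 0 < q) (hq1 : q < 1) {r : ℕ} {h : ℤ} (hhr : (r : ℤ) ≤ h) (n : ℕ) {a b : ℕ}
    (ha : 0 < a) (hb : 0 < b) (w : ℕ) (y : ℝ) :
    ∑ i ∈ Finset.range (n + 1),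
        (n.choose i : ℂ) * ((qnum q a ^ (n - i) : ℝ) : ℂ) * ((qnum q b ^ i : ℝ) : ℂ) *
          genqEuler χ (q ^ a) h r (n - i) y * altqPowerSum χ (q ^ b) h r n i w =
      ((qnum (q ^ a) 2 : ℝ) : ℂ) ^ r * ∑' m : Fin r → ℕ, ∑ j : Fin r → Fin w,
        charSign χ m * charSign χ (fun l => (j l : ℕ)) *
          (qTerm q h n (a * y) (a • m + b • fun l => (j l : ℕ)) : ℂ) := by
  have hterm : ∀ i ∈ Finset.range (n + 1),
      (n.choose i : ℂ) * ((qnum q a ^ (n - i) : ℝ) : ℂ) * ((qnum q b ^ i : ℝ) : ℂ) *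
          genqEuler χ (q ^ a) h r (n - i) y * altqPowerSum χ (q ^ b) h r n i w =
        ((qnum (q ^ a) 2 : ℝ) : ℂ) ^ r * ∑' m : Fin r → ℕ, (n.choose i : ℂ) *
          (((qnum q b ^ i : ℝ) : ℂ) * altqPowerSum χ (q ^ b) h r n i w) *
            (charSign χ m * (qTerm q h (n - i) (a * y) (a • m) : ℂ)) := by
    intro i _
    rw [tsum_mul_left, mul_left_comm, ← qnum_pow_mul_genqEuler χ hq0 hq1 h r (n - i) ha y]
    ring
  rw [Finset.sum_congr rfl hterm, ← Finset.mul_sum, ← Summable.tsum_finsetSum]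
  · congr 1
    refine tsum_congr fun m => ?_
    have hmid : ∀ i ∈ Finset.range (n + 1), (n.choose i : ℂ) *
        (((qnum q b ^ i : ℝ) : ℂ) * altqPowerSum χ (q ^ b) h r n i w) *
          (charSign χ m * (qTerm q h (n - i) (a * y) (a • m) : ℂ)) =
        ∑ j : Fin r → Fin w, charSign χ m * charSign χ (fun l => (j l : ℕ)) *
          (((n.choose i : ℝ) * qTerm q h (n - i) (a * y) (a • m) *
            (qWeight q h (b • fun l => (j l : ℕ)) *
              ((q ^ ∑ l, b * (j l : ℕ)) ^ (n - i) *
                qnum q (∑ l, b * (j l : ℕ) : ℕ) ^ i)) : ℝ) : ℂ) := by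
      intro i hi
      rw [qnum_pow_mul_altqPowerSum χ hq0 hq1 h r (Finset.mem_range_succ_iff.mp hi) hb w,
        Finset.mul_sum, Finset.sum_mul]
      refine Finset.sum_congr rfl fun j _ => ?_
      push_cast
      ring
    rw [Finset.sum_congr rfl hmid, Finset.sum_comm]
    refine Finset.sum_congr rfl fun j _ => ?_
    rw [← Finset.mul_sum, ← Complex.ofReal_sum,
      ← sum_choose_mul_qTerm hq0 h n (a * y) (a • m) (b • fun l => (j l : ℕ))]
    rfl
  · intro i _
    simpa using (summable_charSign_mul_qTerm χ hq0 hq1 hhr (n - i) ha (a * y) 0).mul_left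
      ((n.choose i : ℂ) * (((qnum q b ^ i : ℝ) : ℂ) * altqPowerSum χ (q ^ b) h r n i w))

theorem tsum_eq_tsum_sum_residues {r N : ℕ} (hN : 0 < N) {f : (Fin r → ℕ) → ℂ}
    (hf : Summable f) :
    ∑' m, f m = ∑' k : Fin r → ℕ, ∑ i : Fin r → Fin N, f ((fun l => (i l : ℕ)) + N • k) := by
  have : NeZero N := ⟨hN.ne'⟩
  let e : (Fin r → ℕ) ≃ (Fin r → ℕ) × (Fin r → Fin N) :=
    (Equiv.piCongrRight fun _ => Nat.divModEquiv N).trans (Equiv.arrowProdEquivProdArrow _ _ _)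
  rw [← e.symm.tsum_eq, Summable.tsum_prod (f := fun p => f (e.symm p)) (e.symm.summable_iff.mpr hf)]
  refine tsum_congr fun k => ?_
  rw [tsum_fintype]
  refine Finset.sum_congr rfl fun i _ => congrArg f (funext fun l => ?_)
  change k l * N + (i l : ℕ) = (i l : ℕ) + N * k l
  ring

theorem tsum_sum_charSign_mul_qTerm {d : ℕ} (hd : Odd d) (χ : DirichletCharacter ℂ d) {q : ℝ}
    (hq0 : 0 < q) (hq1 : q < 1) {r : ℕ} {h : ℤ} (hhr : (r : ℤ) ≤ h) (n : ℕ) {a b : ℕ}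
    (ha : 0 < a) (hb : Odd b) (w : ℕ) (y : ℝ) :
    ∑' m : Fin r → ℕ, ∑ j : Fin r → Fin w,
        charSign χ m * charSign χ (fun l => (j l : ℕ)) *
          (qTerm q h n y (a • m + b • fun l => (j l : ℕ)) : ℂ) =
      ∑' k : Fin r → ℕ, ∑ i : Fin r → Fin (b * d), ∑ j : Fin r → Fin w,
        (-1 : ℂ) ^ (∑ l, k l) * charSign χ (fun l => (i l : ℕ)) *
          charSign χ (fun l => (j l : ℕ)) *
          (qTerm q h n y (a • (fun l => (i l : ℕ)) + b • (fun l => (j l : ℕ)) +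
            (a * b * d) • k) : ℂ) := by
  rw [tsum_eq_tsum_sum_residues (hb.mul hd).pos]
  · refine tsum_congr fun k => Finset.sum_congr rfl fun i _ => Finset.sum_congr rfl fun j _ => ?_
    rw [charSign_add_mul hd χ hb, smul_add, smul_smul, ← mul_assoc, add_right_comm]
  · refine summable_sum fun j _ => ?_
    refine ((summable_charSign_mul_qTerm χ hq0 hq1 hhr n ha y
      (b • fun l => (j l : ℕ))).mul_left (charSign χ fun l => (j l : ℕ))).congr fun m => ?_
    ring

/-- Theorem 2.3 (identity of symmetry relating generalized higher-order
`(h,q)`-Euler polynomials and alternating generalized `q`-power sums):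
`[2]_{q^{w₂}}^r Σ_{i=0}^{n} C(n,i) [w₁]_q^{n-i} [w₂]_q^i E_{n-i,χ,q^{w₁}}^{(h,r)}(w₂x)
    S_{n,i,q^{w₂}}^{(h,r)}(w₁d|χ)`
is symmetric under interchanging `w₁` and `w₂`. -/
theorem genqEuler_altqPowerSum_symmetry {d : ℕ} (hd0 : 0 < d) (hdodd : Odd d)
    (χ : DirichletCharacter ℂ d) (q : ℝ) (hq0 : 0 < q) (hq1 : q < 1)
    (r : ℕ) (hr : 1 ≤ r) (h : ℤ) (hhr : (r : ℤ) ≤ h)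
    (n : ℕ) (w₁ w₂ : ℕ) (hw₁ : 0 < w₁) (hw₁odd : Odd w₁) (hw₂ : 0 < w₂) (hw₂odd : Odd w₂)
    (x : ℝ) (hx : 0 < x) :
    ((qnum (q ^ w₂) 2 : ℝ) : ℂ) ^ r *
        ∑ i ∈ Finset.range (n + 1),
          (n.choose i : ℂ) * ((qnum q w₁ ^ (n - i) : ℝ) : ℂ) * ((qnum q w₂ ^ i : ℝ) : ℂ) *
            genqEuler χ (q ^ w₁) h r (n - i) ((w₂ : ℝ) * x) *
            altqPowerSum χ (q ^ w₂) h r n i (w₁ * d)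
      = ((qnum (q ^ w₁) 2 : ℝ) : ℂ) ^ r *
        ∑ i ∈ Finset.range (n + 1),
          (n.choose i : ℂ) * ((qnum q w₂ ^ (n - i) : ℝ) : ℂ) * ((qnum q w₁ ^ i : ℝ) : ℂ) *
            genqEuler χ (q ^ w₂) h r (n - i) ((w₁ : ℝ) * x) *
            altqPowerSum χ (q ^ w₁) h r n i (w₂ * d) := by
  rw [sum_genqEuler_mul_altqPowerSum χ hq0 hq1 hhr n hw₁ hw₂,
    sum_genqEuler_mul_altqPowerSum χ hq0 hq1 hhr n hw₂ hw₁,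
    tsum_sum_charSign_mul_qTerm hdodd χ hq0 hq1 hhr n hw₁ hw₂odd,
    tsum_sum_charSign_mul_qTerm hdodd χ hq0 hq1 hhr n hw₂ hw₁odd, mul_left_comm]
  congr 2
  refine tsum_congr fun k => ?_
  rw [Finset.sum_comm]
  refine Finset.sum_congr rfl fun j _ => Finset.sum_congr rfl fun i _ => ?_
  rw [mul_comm w₁ w₂, mul_left_comm (w₁ : ℝ), add_comm (w₁ • _)]
  ring
end

section
/- For every integer n ≥ 0, all odd positive integers w₁ and w₂, and every real number x, one has [w₁]_q^n · Σ_{j₁,...,j_r = 0}^{w₁d − 1} (−1)^{j₁+⋯+j_r} q^{w₂·Σ_{l=1}^{r}(h−l+1)j_l} (Π_{l=1}^{r} χ(j_l)) · E_{n,χ,q^{w₁}}^{(h,r)}(w₂x + (w₂/w₁)(j₁+⋯+j_r)) = Σ_{i=0}^{n} C(n,i) [w₁]_q^{n−i} [w₂]_q^{i} · E_{n−i,χ,q^{w₁}}^{(h,r)}(w₂x) · S_{n,i,q^{w₂}}^{(h,r)}(w₁d | χ), where C(n,i) denotes the binomial coefficient. -/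
open Finset

/-- The geometric weights `q ^ (m₁ + ⋯ + m_r)` are summable over all tuples of naturals. -/
theorem summable_pow_sum_fin {q : ℝ} (hq0 : 0 ≤ q) (hq1 : q < 1) (r : ℕ) :
    Summable fun m : Fin r → ℕ => q ^ (∑ l, m l) := by
  induction r with
  | zero => exact Summable.of_finite
  | succ r ih =>
    rw [← (Fin.consEquiv fun _ => ℕ).summable_iff]
    refine ((summable_geometric_of_lt_one hq0 hq1).mul_of_nonneg ih
      (fun _ => by positivity) (fun _ => by positivity)).congr fun p => ?_
    simp [Fin.consEquiv, Fin.sum_univ_succ, pow_add]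

theorem norm_qnum_add_natCast_le {q : ℝ} (hq0 : 0 < q) (hq1 : q < 1) (x : ℝ) (k : ℕ) :
    ‖qnum q (x + k)‖ ≤ (1 + q ^ x) / (1 - q) := by
  have hq : 0 < 1 - q := sub_pos.2 hq1
  have hx : 0 < q ^ x := Real.rpow_pos_of_pos hq0 x
  have hk : q ^ (x + k) ≤ q ^ x :=
    Real.rpow_le_rpow_of_exponent_ge hq0 hq1.le (by simp)
  have hk0 : 0 < q ^ (x + k) := Real.rpow_pos_of_pos hq0 _
  rw [qnum, norm_div, Real.norm_of_nonneg hq.le]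
  gcongr
  rw [Real.norm_eq_abs, abs_le]
  constructor <;> linarith

/-- Absolute convergence of the series defining `genqEuler`. -/
theorem summable_genqEuler {d : ℕ} (χ : DirichletCharacter ℂ d) {q : ℝ} (hq0 : 0 < q)
    (hq1 : q < 1) {h : ℤ} {r : ℕ} (hhr : (r : ℤ) ≤ h) (n : ℕ) (x : ℝ) :
    Summable fun m : Fin r → ℕ =>
      ((q ^ (∑ l : Fin r, (h - (l.val : ℤ)) * (m l : ℤ)) : ℝ) : ℂ) *
        (-1 : ℂ) ^ (∑ l : Fin r, m l) * (∏ l : Fin r, χ ((m l : ℕ) : ZMod d)) *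
        ((qnum q (x + ∑ l : Fin r, (m l : ℝ)) ^ n : ℝ) : ℂ) := by
  refine Summable.of_norm_bounded
    ((summable_pow_sum_fin hq0.le hq1 r).mul_right (((1 + q ^ x) / (1 - q)) ^ n)) fun m => ?_
  have hweight : q ^ (∑ l : Fin r, (h - (l.val : ℤ)) * (m l : ℤ)) ≤ q ^ (∑ l, m l) := by
    rw [← zpow_natCast q (∑ l, m l)]
    refine zpow_le_zpow_right_of_le_one₀ hq0 hq1.le ?_
    push_cast
    refine Finset.sum_le_sum fun l _ => le_mul_of_one_le_left (by positivity) ?_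
    have := l.isLt
    omega
  have hχ : ‖∏ l : Fin r, χ ((m l : ℕ) : ZMod d)‖ ≤ 1 := by
    rw [norm_prod]
    exact Finset.prod_le_one (fun _ _ => norm_nonneg _) fun _ _ => χ.norm_le_one _
  have hqnum : ‖qnum q (x + ∑ l : Fin r, (m l : ℝ))‖ ≤ (1 + q ^ x) / (1 - q) := by
    simpa using norm_qnum_add_natCast_le hq0 hq1 x (∑ l, m l)
  rw [norm_mul, norm_mul, norm_mul, norm_pow, norm_neg, norm_one, one_pow, mul_one,
    Complex.norm_real, Complex.norm_real, norm_pow, Real.norm_of_nonneg (by positivity)]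
  gcongr
  calc _ ≤ q ^ (∑ l, m l) * 1 := by gcongr
    _ = _ := mul_one _

/-- Splitting of a `q`-number with respect to the rescaled bases `q ^ w₁` and `q ^ w₂`. -/
theorem qnum_mul_qnum_pow_add {q : ℝ} (hq0 : 0 < q) (hq1 : q < 1) {w₁ w₂ : ℕ} (hw₁ : 0 < w₁)
    (hw₂ : 0 < w₂) (y : ℝ) (k : ℕ) :
    qnum q w₁ * qnum (q ^ w₁) (y + (w₂ : ℝ) / w₁ * k) =
      qnum q w₂ * qnum (q ^ w₂) k + (q ^ w₂) ^ k * (qnum q w₁ * qnum (q ^ w₁) y) := by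
  have hq : 1 - q ≠ 0 := (sub_pos.2 hq1).ne'
  have h₁ : 1 - q ^ w₁ ≠ 0 := (sub_pos.2 (pow_lt_one₀ hq0.le hq1 hw₁.ne')).ne'
  have h₂ : 1 - q ^ w₂ ≠ 0 := (sub_pos.2 (pow_lt_one₀ hq0.le hq1 hw₂.ne')).ne'
  have hw : (w₁ : ℝ) ≠ 0 := by positivity
  have hexp : (q ^ w₁) ^ ((w₂ : ℝ) / w₁ * k) = (q ^ w₂) ^ k := by
    rw [← Real.rpow_natCast q w₁, ← Real.rpow_mul hq0.le, ← pow_mul,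
      ← Real.rpow_natCast q (w₂ * k)]
    congr 1
    push_cast
    field_simp
  simp only [qnum]
  rw [Real.rpow_add (by positivity), hexp]
  simp only [Real.rpow_natCast]
  field_simp
  ring

/-- Expansion of a shifted `(h,q)`-Euler polynomial in lower-degree unshifted ones. -/
theorem qnum_pow_mul_genqEuler_add {d : ℕ} (χ : DirichletCharacter ℂ d) {q : ℝ} (hq0 : 0 < q)
    (hq1 : q < 1) {h : ℤ} {r : ℕ} (hhr : (r : ℤ) ≤ h) (n : ℕ) {w₁ w₂ : ℕ} (hw₁ : 0 < w₁)
    (hw₂ : 0 < w₂) (y : ℝ) (k : ℕ) :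
    ((qnum q w₁ ^ n : ℝ) : ℂ) * genqEuler χ (q ^ w₁) h r n (y + (w₂ : ℝ) / w₁ * k) =
      ∑ i ∈ Finset.range (n + 1),
        (n.choose i : ℂ) * ((qnum q w₁ ^ (n - i) : ℝ) : ℂ) * ((qnum q w₂ ^ i : ℝ) : ℂ) *
          ((qnum (q ^ w₂) k ^ i : ℝ) : ℂ) * ((((q ^ w₂) ^ k) ^ (n - i) : ℝ) : ℂ) *
          genqEuler χ (q ^ w₁) h r (n - i) y := by
  have hQ0 : 0 < q ^ w₁ := by positivity
  have hQ1 : q ^ w₁ < 1 := pow_lt_one₀ hq0.le hq1 hw₁.ne'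
  simp only [genqEuler]
  simp_rw [mul_left_comm _ (((qnum (q ^ w₁) 2 : ℝ) : ℂ) ^ r)]
  rw [← Finset.mul_sum]
  congr 1
  simp_rw [← tsum_mul_left]
  rw [← Summable.tsum_finsetSum fun i _ =>
    (summable_genqEuler χ hQ0 hQ1 hhr (n - i) y).mul_left _]
  refine tsum_congr fun m => ?_
  have key := qnum_mul_qnum_pow_add hq0 hq1 hw₁ hw₂ (y + ∑ l : Fin r, (m l : ℝ)) k
  rw [add_right_comm] at key
  rw [mul_left_comm, ← Complex.ofReal_mul, ← mul_pow, key, add_pow, Complex.ofReal_sum,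
    Finset.mul_sum]
  refine Finset.sum_congr rfl fun i _ => ?_
  push_cast
  ring

/-- Equation (2.5)/(2.7): the single-sum expansion
`[w₁]_q^n Σ_{j₁,…,j_r=0}^{w₁d-1} (-1)^{Σ j_l} q^{w₂ Σ (h-l+1) j_l} (Π χ(j_l))
    E_{n,χ,q^{w₁}}^{(h,r)}(w₂x + (w₂/w₁)Σ j_l)
  = Σ_{i=0}^{n} C(n,i) [w₁]_q^{n-i} [w₂]_q^i E_{n-i,χ,q^{w₁}}^{(h,r)}(w₂x)
    S_{n,i,q^{w₂}}^{(h,r)}(w₁d|χ)`. -/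
theorem genqEuler_sum_eq_binomial_altqPowerSum {d : ℕ} (hd0 : 0 < d) (hdodd : Odd d)
    (χ : DirichletCharacter ℂ d) (q : ℝ) (hq0 : 0 < q) (hq1 : q < 1)
    (r : ℕ) (hr : 1 ≤ r) (h : ℤ) (hhr : (r : ℤ) ≤ h)
    (n : ℕ) (w₁ w₂ : ℕ) (hw₁ : 0 < w₁) (hw₁odd : Odd w₁) (hw₂ : 0 < w₂) (hw₂odd : Odd w₂)
    (x : ℝ) :
    ((qnum q w₁ ^ n : ℝ) : ℂ) *
        ∑ j : Fin r → Fin (w₁ * d),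
          (-1 : ℂ) ^ (∑ l : Fin r, (j l : ℕ)) *
            ((q ^ ((w₂ : ℤ) * ∑ l : Fin r, (h - (l.val : ℤ)) * ((j l : ℕ) : ℤ)) : ℝ) : ℂ) *
            (∏ l : Fin r, χ ((j l : ℕ) : ZMod d)) *
            genqEuler χ (q ^ w₁) h r n
              ((w₂ : ℝ) * x + ((w₂ : ℝ) / (w₁ : ℝ)) * ∑ l : Fin r, ((j l : ℕ) : ℝ))
      = ∑ i ∈ Finset.range (n + 1),
          (n.choose i : ℂ) * ((qnum q w₁ ^ (n - i) : ℝ) : ℂ) * ((qnum q w₂ ^ i : ℝ) : ℂ) *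
            genqEuler χ (q ^ w₁) h r (n - i) ((w₂ : ℝ) * x) *
            altqPowerSum χ (q ^ w₂) h r n i (w₁ * d) := by
  rw [Finset.mul_sum]
  conv_rhs => enter [2, i]; rw [altqPowerSum, Finset.mul_sum]
  rw [Finset.sum_comm]
  refine Finset.sum_congr rfl fun j _ => ?_
  have key := qnum_pow_mul_genqEuler_add χ hq0 hq1 hhr n hw₁ hw₂ (w₂ * x) (∑ l, (j l : ℕ))
  rw [Nat.cast_sum] at key
  rw [mul_left_comm, key, Finset.mul_sum]
  refine Finset.sum_congr rfl fun i hi => ?_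
  have hin : i ≤ n := Finset.mem_range_succ_iff.1 hi
  have hexp : (q ^ w₂) ^ (∑ l : Fin r, (h - (l.val : ℤ) + (n : ℤ) - (i : ℤ)) * ((j l : ℕ) : ℤ)) =
      q ^ ((w₂ : ℤ) * ∑ l : Fin r, (h - (l.val : ℤ)) * ((j l : ℕ) : ℤ)) *
        ((q ^ w₂) ^ (∑ l, (j l : ℕ))) ^ (n - i) := by
    rw [← pow_mul, ← zpow_natCast (q ^ w₂), zpow_mul, zpow_natCast,
      ← zpow_add₀ (by positivity)]
    congr 1
    push_cast [Nat.cast_sub hin]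
    rw [Finset.sum_mul, ← Finset.sum_add_distrib]
    exact Finset.sum_congr rfl fun l _ => by ring
  rw [hexp]
  push_cast
  ring
end
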